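/- arXiv:math/0405319 — 2 statements merged into one kernel-verified Lean document; each statement's English description precedes it below -/
import Mathlib

section
/- If a quadratic differential system possesses invariant affine lines in at least three pairwise distinct directions (i.e., three invariant lines uᵢx+vᵢy+wᵢ = 0, i = 1,2,3, with the vectors (uᵢ,vᵢ) pairwise non-proportional over ℂ), then B3(x,y) = 0 identically as a polynomial in x,y. -/
open MvPolynomial

noncomputable section

/-- The affine line `u·x + v·y + w = 0` as a polynomial over `ℂ`. -/
def linePoly (u v w : ℂ) : MvPolynomial (Fin 2) ℂ :=
  C u * X 0 + C v * X 1 + C w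

/-- `ux + vy + w = 0` is an invariant affine line of the system `ẋ = p, ẏ = q`. -/
def IsInvLine (p q : MvPolynomial (Fin 2) ℝ) (u v w : ℂ) : Prop :=
  ∃ k : MvPolynomial (Fin 2) ℂ,
    (MvPolynomial.map (algebraMap ℝ ℂ) p) * pderiv 0 (linePoly u v w) +
      (MvPolynomial.map (algebraMap ℝ ℂ) q) * pderiv 1 (linePoly u v w) =
      linePoly u v w * k

/-- `c0 + c10·x + c01·y + c20·x² + 2c11·xy + c02·y²`. -/
def quadPoly (c0 c10 c01 c20 c11 c02 : ℝ) : MvPolynomial (Fin 2) ℝ :=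
  C c0 + C c10 * X 0 + C c01 * X 1 +
    C c20 * X 0 ^ 2 + C (2 * c11) * (X 0 * X 1) + C c02 * X 1 ^ 2

/-- The binary quadratic form `c20·x² + 2c11·xy + c02·y²`. -/
def quadForm (c20 c11 c02 : ℝ) : MvPolynomial (Fin 2) ℝ :=
  C c20 * X 0 ^ 2 + C (2 * c11) * (X 0 * X 1) + C c02 * X 1 ^ 2

/-- `C2(x,y) = y·p₂(x,y) − x·q₂(x,y)`. -/
def C2poly (a20 a11 a02 b20 b11 b02 : ℝ) : MvPolynomial (Fin 2) ℝ :=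
  X 1 * quadForm a20 a11 a02 - X 0 * quadForm b20 b11 b02

/-- `D(x,y) = 4·det(c_ij)` where `x·Q(X,Y,Z) − y·P(X,Y,Z)
  = c11·X² + 2c12·XY + c22·Y² + 2c13·XZ + 2c23·YZ + c33·Z²`. -/
def Dpoly (a00 a10 a01 a20 a11 a02 b00 b10 b01 b20 b11 b02 : ℝ) :
    MvPolynomial (Fin 2) ℝ :=
  let c11 : MvPolynomial (Fin 2) ℝ := C b20 * X 0 - C a20 * X 1
  let c12 : MvPolynomial (Fin 2) ℝ := C b11 * X 0 - C a11 * X 1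
  let c22 : MvPolynomial (Fin 2) ℝ := C b02 * X 0 - C a02 * X 1
  let c13 : MvPolynomial (Fin 2) ℝ := C (b10 / 2) * X 0 - C (a10 / 2) * X 1
  let c23 : MvPolynomial (Fin 2) ℝ := C (b01 / 2) * X 0 - C (a01 / 2) * X 1
  let c33 : MvPolynomial (Fin 2) ℝ := C b00 * X 0 - C a00 * X 1
  4 * Matrix.det !![c11, c12, c13; c12, c22, c23; c13, c23, c33]

/-- `B3 = (C2, D)^(1)`, the Jacobian of `C2` and `D`. -/
def B3poly (a00 a10 a01 a20 a11 a02 b00 b10 b01 b20 b11 b02 : ℝ) :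
    MvPolynomial (Fin 2) ℝ :=
  pderiv 0 (C2poly a20 a11 a02 b20 b11 b02) *
      pderiv 1 (Dpoly a00 a10 a01 a20 a11 a02 b00 b10 b01 b20 b11 b02)
    - pderiv 1 (C2poly a20 a11 a02 b20 b11 b02) *
      pderiv 0 (Dpoly a00 a10 a01 a20 a11 a02 b00 b10 b01 b20 b11 b02)

lemma cubic_of_roots (c0 c1 c2 c3 : ℂ) (s t : Fin 3 → ℂ)
    (h0 : ∀ i, s i ≠ 0 ∨ t i ≠ 0)
    (h01 : t 0 * s 1 - s 0 * t 1 ≠ 0) (h02 : t 0 * s 2 - s 0 * t 2 ≠ 0)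
    (h12 : t 1 * s 2 - s 1 * t 2 ≠ 0)
    (h : ∀ i, c0 * s i ^ 3 + c1 * s i ^ 2 * t i + c2 * s i * t i ^ 2 + c3 * t i ^ 3 = 0) :
    ∃ l : ℂ, c0 = l * (t 0 * t 1 * t 2) ∧
      c1 = - l * (s 0 * t 1 * t 2 + t 0 * s 1 * t 2 + t 0 * t 1 * s 2) ∧
      c2 = l * (s 0 * s 1 * t 2 + s 0 * t 1 * s 2 + t 0 * s 1 * s 2) ∧
      c3 = - l * (s 0 * s 1 * s 2) := by
  obtain ⟨a, b, c, e0, e1, e2, e3⟩ : ∃ a b c : ℂ, c0 = t 0 * a ∧ c1 = t 0 * b - s 0 * a ∧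
      c2 = t 0 * c - s 0 * b ∧ c3 = - s 0 * c := by
    have hh := h 0
    rcases h0 0 with hs | ht
    · refine ⟨-(c1 - t 0 * (-(c2 - t 0 * (-c3 / s 0)) / s 0)) / s 0,
        -(c2 - t 0 * (-c3 / s 0)) / s 0, -c3 / s 0, ?_, ?_, ?_, ?_⟩ <;> field_simp <;>
        first | ring1 | linear_combination hh
    · refine ⟨c0 / t 0, (c1 + s 0 * (c0 / t 0)) / t 0,
        (c2 + s 0 * ((c1 + s 0 * (c0 / t 0)) / t 0)) / t 0, ?_, ?_, ?_, ?_⟩ <;> field_simp <;>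
        first | ring1 | linear_combination hh
  have q : ∀ i, t 0 * s i - s 0 * t i ≠ 0 → a * s i ^ 2 + b * s i * t i + c * t i ^ 2 = 0 := by
    intro i hi
    have := h i
    subst e0 e1 e2 e3
    apply (mul_eq_zero.mp (?_ : (t 0 * s i - s 0 * t i) * _ = 0)).resolve_left hi
    linear_combination this
  have q1 := q 1 h01
  have q2 := q 2 h02
  obtain ⟨f, g, k0, k1, k2⟩ : ∃ f g : ℂ, a = t 1 * f ∧ b = t 1 * g - s 1 * f ∧
      c = - s 1 * g := by
    rcases h0 1 with hs | ht
    · refine ⟨-(b - t 1 * (-c / s 1)) / s 1, -c / s 1, ?_, ?_, ?_⟩ <;> field_simp <;>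
        first | ring1 | linear_combination q1
    · refine ⟨a / t 1, (b + s 1 * (a / t 1)) / t 1, ?_, ?_, ?_⟩ <;> field_simp <;>
        first | ring1 | linear_combination q1
  have r2 : f * s 2 + g * t 2 = 0 := by
    subst k0 k1 k2
    apply (mul_eq_zero.mp (?_ : (t 1 * s 2 - s 1 * t 2) * _ = 0)).resolve_left h12
    linear_combination q2
  obtain ⟨l, l0, l1⟩ : ∃ l : ℂ, f = l * t 2 ∧ g = - l * s 2 := by
    rcases h0 2 with hs | ht
    · refine ⟨-g / s 2, ?_, ?_⟩ <;> field_simp <;> first | ring1 | linear_combination r2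
    · refine ⟨f / t 2, ?_, ?_⟩ <;> field_simp <;> first | ring1 | linear_combination r2
  refine ⟨l, ?_, ?_, ?_, ?_⟩ <;> subst e0 e1 e2 e3 k0 k1 k2 l0 l1 <;> ring

lemma factor_aux (g00 g10 g01 g20 g11 g02 u v w : ℂ) (hu : u ≠ 0)
    (h : ∀ x y : ℂ, u * x + v * y + w = 0 →
      g00 + g10 * x + g01 * y + g20 * x ^ 2 + 2 * g11 * (x * y) + g02 * y ^ 2 = 0) :
    ∃ a b c : ℂ, g20 = u * a ∧ 2 * g11 = u * b + v * a ∧ g02 = v * b ∧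
      g10 = u * c + w * a ∧ g01 = v * c + w * b ∧ g00 = w * c := by
  obtain ⟨a, ha⟩ : ∃ a, g20 = u * a := ⟨g20 / u, by field_simp⟩
  obtain ⟨b, hb⟩ : ∃ b, 2 * g11 = u * b + v * a := ⟨(2 * g11 - v * a) / u, by field_simp; ring⟩
  obtain ⟨c, hc⟩ : ∃ c, g10 = u * c + w * a := ⟨(g10 - w * a) / u, by field_simp; ring⟩
  have key : ∀ y : ℂ, (g00 - w * c) + (g01 - v * c - w * b) * y + (g02 - v * b) * y ^ 2 = 0 := by
    intro y
    obtain ⟨x, hx⟩ : ∃ x, u * x + v * y + w = 0 := ⟨-(v * y + w) / u, by field_simp; ring⟩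
    have := h x y hx
    rw [ha, hb, hc] at this
    linear_combination this - (a * x + b * y + c) * hx
  have k0 := key 0
  have k1 := key 1
  have k2 := key (-1)
  refine ⟨a, b, c, ha, hb, ?_, hc, ?_, ?_⟩
  · linear_combination (k1 + k2) / 2 - k0
  · linear_combination (k1 - k2) / 2
  · linear_combination k0

lemma factor (g00 g10 g01 g20 g11 g02 u v w : ℂ) (hu : u ≠ 0 ∨ v ≠ 0)
    (h : ∀ x y : ℂ, u * x + v * y + w = 0 →
      g00 + g10 * x + g01 * y + g20 * x ^ 2 + 2 * g11 * (x * y) + g02 * y ^ 2 = 0) :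
    ∃ a b c : ℂ, g20 = u * a ∧ 2 * g11 = u * b + v * a ∧ g02 = v * b ∧
      g10 = u * c + w * a ∧ g01 = v * c + w * b ∧ g00 = w * c := by
  rcases hu with hu | hv
  · exact factor_aux _ _ _ _ _ _ _ _ _ hu h
  · obtain ⟨a, b, c, h1, h2, h3, h4, h5, h6⟩ :=
      factor_aux g00 g01 g10 g02 g11 g20 v u w hv (fun x y hxy => by
        linear_combination h y x (by linear_combination hxy))
    exact ⟨b, a, c, h3, by linear_combination h2, h1, h5, h4, h6⟩

/-- value of `D` -/
def Dval {R : Type} [CommRing R] (a00 a10 a01 a20 a11 a02 b00 b10 b01 b20 b11 b02 x y : R) : R :=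
  4 * (b20 * x - a20 * y) * (b02 * x - a02 * y) * (b00 * x - a00 * y)
  + 2 * (b11 * x - a11 * y) * (b01 * x - a01 * y) * (b10 * x - a10 * y)
  - (b20 * x - a20 * y) * (b01 * x - a01 * y) ^ 2
  - (b02 * x - a02 * y) * (b10 * x - a10 * y) ^ 2
  - 4 * (b00 * x - a00 * y) * (b11 * x - a11 * y) ^ 2

lemma Dval_expand (a00 a10 a01 a20 a11 a02 b00 b10 b01 b20 b11 b02 : ℝ) :
    ∃ d0 d1 d2 d3 : ℝ,
      Dpoly a00 a10 a01 a20 a11 a02 b00 b10 b01 b20 b11 b02 =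
        C d0 * X 0 ^ 3 + C d1 * (X 0 ^ 2 * X 1) + C d2 * (X 0 * X 1 ^ 2) + C d3 * X 1 ^ 3 ∧
      ∀ x y : ℂ, Dval (a00 : ℂ) a10 a01 a20 a11 a02 b00 b10 b01 b20 b11 b02 x y =
        d0 * x ^ 3 + d1 * x ^ 2 * y + d2 * x * y ^ 2 + d3 * y ^ 3 := by
  let F : ℝ → ℝ → ℝ := Dval a00 a10 a01 a20 a11 a02 b00 b10 b01 b20 b11 b02
  refine ⟨F 1 0, (F 1 1 - F 1 (-1)) / 2 - F 0 1,
    (F 1 1 + F 1 (-1)) / 2 - F 1 0, F 0 1, ?_, ?_⟩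
  · apply MvPolynomial.funext
    intro x
    simp only [Dpoly, Matrix.det_fin_three, F, Dval]
    simp
    ring
  · intro x y
    simp only [F, Dval]
    push_cast
    ring

lemma C2_expand (a20 a11 a02 b20 b11 b02 : ℝ) :
    C2poly a20 a11 a02 b20 b11 b02 =
      C (-b20) * X 0 ^ 3 + C (a20 - 2 * b11) * (X 0 ^ 2 * X 1)
      + C (2 * a11 - b02) * (X 0 * X 1 ^ 2) + C a02 * X 1 ^ 3 := by
  apply MvPolynomial.funext
  intro x
  simp [C2poly, quadForm]
  ring

lemma inv_eval (a00 a10 a01 a20 a11 a02 b00 b10 b01 b20 b11 b02 : ℝ) (u v w : ℂ)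
    (h : IsInvLine (quadPoly a00 a10 a01 a20 a11 a02) (quadPoly b00 b10 b01 b20 b11 b02) u v w)
    (x y : ℂ) (hxy : u * x + v * y + w = 0) :
    (u * a00 + v * b00) + (u * a10 + v * b10) * x + (u * a01 + v * b01) * y
      + (u * a20 + v * b20) * x ^ 2 + 2 * (u * a11 + v * b11) * (x * y)
      + (u * a02 + v * b02) * y ^ 2 = 0 := by
  obtain ⟨k, hk⟩ := h
  have := congrArg (eval ![x, y]) hk
  simp [linePoly, quadPoly, pderiv_X, hxy] at this
  linear_combination this

lemma inv_vanish (a00 a10 a01 a20 a11 a02 b00 b10 b01 b20 b11 b02 : ℝ) (u v w : ℂ)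
    (hu : u ≠ 0 ∨ v ≠ 0)
    (h : IsInvLine (quadPoly a00 a10 a01 a20 a11 a02) (quadPoly b00 b10 b01 b20 b11 b02) u v w) :
    Dval (a00 : ℂ) a10 a01 a20 a11 a02 b00 b10 b01 b20 b11 b02 v (-u) = 0 ∧
    ((-b20 : ℝ) : ℂ) * v ^ 3 + ((a20 - 2 * b11 : ℝ) : ℂ) * v ^ 2 * (-u)
      + ((2 * a11 - b02 : ℝ) : ℂ) * v * (-u) ^ 2 + (a02 : ℂ) * (-u) ^ 3 = 0 := by
  obtain ⟨a, b, c, h1, h2, h3, h4, h5, h6⟩ := factor _ _ _ _ _ _ u v w hu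
    (fun x y hxy => inv_eval _ _ _ _ _ _ _ _ _ _ _ _ u v w h x y hxy)
  constructor
  · have e : ∀ p q : ℂ, q * v - p * (-u) = u * p + v * q := fun p q => by ring
    have h2' : u * (a11 : ℂ) + v * b11 = (u * b + v * a) / 2 := by linear_combination h2 / 2
    simp only [Dval, e, h1, h2', h3, h4, h5, h6]
    ring
  · push_cast
    linear_combination (-v ^ 2) * h1 + u * v * h2 - u ^ 2 * h3

/-- If a quadratic differential system possesses invariant affine lines in at least three
pairwise distinct directions, then `B3 = 0` identically. -/
theorem B3_vanishes_of_three_directions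
    (a00 a10 a01 a20 a11 a02 b00 b10 b01 b20 b11 b02 : ℝ)
    (hdeg : ¬ (a20 = 0 ∧ a11 = 0 ∧ a02 = 0 ∧ b20 = 0 ∧ b11 = 0 ∧ b02 = 0))
    (u v w : Fin 3 → ℂ)
    (hnz : ∀ i, (u i, v i) ≠ (0, 0))
    (hdir : ∀ i j, i ≠ j → ¬ ∃ c : ℂ, u j = c * u i ∧ v j = c * v i)
    (hinv : ∀ i, IsInvLine (quadPoly a00 a10 a01 a20 a11 a02)
                           (quadPoly b00 b10 b01 b20 b11 b02) (u i) (v i) (w i)) :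
    B3poly a00 a10 a01 a20 a11 a02 b00 b10 b01 b20 b11 b02 = 0 := by
  have hn : ∀ i, u i ≠ 0 ∨ v i ≠ 0 := by
    intro i
    by_contra hc
    push Not at hc
    exact hnz i (by rw [hc.1, hc.2])
  have hd : ∀ i j, i ≠ j → (-u i) * v j - v i * (-u j) ≠ 0 := by
    intro i j hij h0
    apply hdir i j hij
    rcases hn i with h | h
    · refine ⟨u j / u i, by field_simp, ?_⟩
      field_simp
      linear_combination -h0
    · refine ⟨v j / v i, ?_, by field_simp⟩
      field_simp
      linear_combination h0
  obtain ⟨d0, d1, d2, d3, hD, hDv⟩ :=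
    Dval_expand a00 a10 a01 a20 a11 a02 b00 b10 b01 b20 b11 b02
  have hv := fun i => inv_vanish _ _ _ _ _ _ _ _ _ _ _ _ _ _ _ (hn i) (hinv i)
  have hn' : ∀ i, v i ≠ 0 ∨ -u i ≠ 0 := fun i => (hn i).symm.imp id neg_ne_zero.mpr
  obtain ⟨l, l0, l1, l2, l3⟩ := cubic_of_roots d0 d1 d2 d3 v (fun i => -u i) hn'
    (hd 0 1 (by decide)) (hd 0 2 (by decide)) (hd 1 2 (by decide))
    (fun i => by rw [← hDv]; exact (hv i).1)
  obtain ⟨m, m0, m1, m2, m3⟩ := cubic_of_roots _ _ _ _ v (fun i => -u i) hn'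
    (hd 0 1 (by decide)) (hd 0 2 (by decide)) (hd 1 2 (by decide))
    (fun i => (hv i).2)
  unfold B3poly
  rw [hD, C2_expand]
  generalize -b20 = c0 at *
  generalize a20 - 2 * b11 = c1 at *
  generalize 2 * a11 - b02 = c2 at *
  have e01 : c0 * d1 - c1 * d0 = 0 := by
    have : (c0 * d1 - c1 * d0 : ℂ) = 0 := by rw [l0, l1, m0, m1]; ring
    exact_mod_cast this
  have e02 : c0 * d2 - c2 * d0 = 0 := by
    have : (c0 * d2 - c2 * d0 : ℂ) = 0 := by rw [l0, l2, m0, m2]; ring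
    exact_mod_cast this
  have e03 : c0 * d3 - a02 * d0 = 0 := by
    have : (c0 * d3 - a02 * d0 : ℂ) = 0 := by rw [l0, l3, m0, m3]; ring
    exact_mod_cast this
  have e12 : c1 * d2 - c2 * d1 = 0 := by
    have : (c1 * d2 - c2 * d1 : ℂ) = 0 := by rw [l1, l2, m1, m2]; ring
    exact_mod_cast this
  have e13 : c1 * d3 - a02 * d1 = 0 := by
    have : (c1 * d3 - a02 * d1 : ℂ) = 0 := by rw [l1, l3, m1, m3]; ring
    exact_mod_cast this
  have e23 : c2 * d3 - a02 * d2 = 0 := by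
    have : (c2 * d3 - a02 * d2 : ℂ) = 0 := by rw [l2, l3, m2, m3]; ring
    exact_mod_cast this
  apply MvPolynomial.funext
  intro x
  simp [pderiv_X]
  linear_combination 3 * e01 * x 0 ^ 4 + 6 * e02 * x 0 ^ 3 * x 1 + 9 * e03 * x 0 ^ 2 * x 1 ^ 2
    + 3 * e12 * x 0 ^ 2 * x 1 ^ 2 + 6 * e13 * x 0 * x 1 ^ 3 + 3 * e23 * x 1 ^ 4
end
end

section
/- If a quadratic differential system possesses two couples of distinct parallel invariant affine lines in two non-proportional directions (i.e., invariant lines u₁x+v₁y+w₁ = 0, u₁x+v₁y+w₁' = 0 with w₁ ≠ w₁', and u₂x+v₂y+w₂ = 0, u₂x+v₂y+w₂' = 0 with w₂ ≠ w₂', where (u₁,v₁) and (u₂,v₂) are non-proportional over ℂ), then N(x,y) = 0 identically. -/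
open MvPolynomial

noncomputable section

/-- `K(x,y) = Jacobian(p₂,q₂)`. -/
def Kpoly (a20 a11 a02 b20 b11 b02 : ℝ) : MvPolynomial (Fin 2) ℝ :=
  pderiv 0 (quadForm a20 a11 a02) * pderiv 1 (quadForm b20 b11 b02)
    - pderiv 1 (quadForm a20 a11 a02) * pderiv 0 (quadForm b20 b11 b02)

/-- `H(x,y) = 4[(b20·x − a20·y)(b02·x − a02·y) − (b11·x − a11·y)²]`. -/
def Hpoly (a20 a11 a02 b20 b11 b02 : ℝ) : MvPolynomial (Fin 2) ℝ :=
  4 * ((C b20 * X 0 - C a20 * X 1) * (C b02 * X 0 - C a02 * X 1)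
        - (C b11 * X 0 - C a11 * X 1) ^ 2)

/-- `N(x,y) = K(x,y) + H(x,y)`. -/
def Npoly (a20 a11 a02 b20 b11 b02 : ℝ) : MvPolynomial (Fin 2) ℝ :=
  Kpoly a20 a11 a02 b20 b11 b02 + Hpoly a20 a11 a02 b20 b11 b02

theorem aux_eval (a0 a1 a2 a20 a11 a02 b0 b1 b2 b20 b11 b02 : ℝ) (u v w : ℂ)
    (h : IsInvLine (quadPoly a0 a1 a2 a20 a11 a02) (quadPoly b0 b1 b2 b20 b11 b02) u v w)
    (x y : ℂ) (hxy : u * x + v * y + w = 0) :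
    (u * a0 + v * b0) + (u * a1 + v * b1) * x + (u * a2 + v * b2) * y
      + (u * a20 + v * b20) * x ^ 2 + 2 * (u * a11 + v * b11) * x * y
      + (u * a02 + v * b02) * y ^ 2 = 0 := by
  obtain ⟨k, hk⟩ := h
  have h2 := congrArg (MvPolynomial.eval ![x, y]) hk
  simp [linePoly, quadPoly, pderiv_X, hxy] at h2
  linear_combination h2

theorem aux_sq (F0 F1 F2 A B E u v w w' : ℂ) (hnz : (u, v) ≠ (0, 0)) (hw : w ≠ w')
    (h : ∀ x y : ℂ, u * x + v * y + w = 0 →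
      F0 + F1 * x + F2 * y + A * x ^ 2 + 2 * B * x * y + E * y ^ 2 = 0)
    (h' : ∀ x y : ℂ, u * x + v * y + w' = 0 →
      F0 + F1 * x + F2 * y + A * x ^ 2 + 2 * B * x * y + E * y ^ 2 = 0) :
    ∃ c : ℂ, A = c * u ^ 2 ∧ B = c * (u * v) ∧ E = c * v ^ 2 := by
  obtain ⟨e, f, hef⟩ : ∃ e f : ℂ, u * e + v * f = 1 := by
    by_cases hu : u = 0
    · have hv : v ≠ 0 := by
        rintro rfl
        exact hnz (by rw [hu])
      exact ⟨0, v⁻¹, by simp [hv]⟩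
    · exact ⟨u⁻¹, 0, by simp [hu]⟩
  have g : ∀ t : ℂ, _ := fun t => h (-w * e + t * v) (-w * f - t * u)
    (by linear_combination (-w) * hef)
  have g' : ∀ t : ℂ, _ := fun t => h' (-w' * e + t * v) (-w' * f - t * u)
    (by linear_combination (-w') * hef)
  have q : A * v ^ 2 - 2 * B * u * v + E * u ^ 2 = 0 := by
    linear_combination (1 / 2) * g 1 + (1 / 2) * g (-1) - g 0
  have m0 : (w - w') * (A * e * v + B * (f * v - e * u) - E * f * u) = 0 := by
    linear_combination (-1 / 4) * (g 1 - g (-1)) + (1 / 4) * (g' 1 - g' (-1))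
  have m := (mul_eq_zero.mp m0).resolve_left (sub_ne_zero.mpr hw)
  refine ⟨A * e ^ 2 + 2 * B * e * f + E * f ^ 2, ?_, ?_, ?_⟩
  · have : A * (u * e + v * f) ^ 2 = (A * e ^ 2 + 2 * B * e * f + E * f ^ 2) * u ^ 2 := by
      linear_combination (2 * u * f) * m + f ^ 2 * q
    simpa [hef] using this
  · have : B * (u * e + v * f) ^ 2 = (A * e ^ 2 + 2 * B * e * f + E * f ^ 2) * (u * v) := by
      linear_combination (v * f - u * e) * m - (e * f) * q
    simpa [hef] using this
  · have : E * (u * e + v * f) ^ 2 = (A * e ^ 2 + 2 * B * e * f + E * f ^ 2) * v ^ 2 := by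
      linear_combination (-2 * v * e) * m + e ^ 2 * q
    simpa [hef] using this

theorem aux_alg (a20 a11 a02 b20 b11 b02 u v s t c d : ℂ) (hD : u * t - s * v ≠ 0)
    (h1 : u * a20 + v * b20 = c * u ^ 2) (h2 : u * a11 + v * b11 = c * (u * v))
    (h3 : u * a02 + v * b02 = c * v ^ 2)
    (k1 : s * a20 + t * b20 = d * s ^ 2) (k2 : s * a11 + t * b11 = d * (s * t))
    (k3 : s * a02 + t * b02 = d * t ^ 2) :
    a20 * b11 - a11 * b20 + b20 * b02 - b11 ^ 2 = 0 ∧ a11 * b11 - a02 * b20 = 0 ∧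
      a11 * b02 - a02 * b11 + a20 * a02 - a11 ^ 2 = 0 := by
  have e1 : a20 = (t * (c * u ^ 2) - v * (d * s ^ 2)) / (u * t - s * v) := by
    rw [eq_div_iff hD]; linear_combination t * h1 - v * k1
  have e2 : a11 = (t * (c * (u * v)) - v * (d * (s * t))) / (u * t - s * v) := by
    rw [eq_div_iff hD]; linear_combination t * h2 - v * k2
  have e3 : a02 = (t * (c * v ^ 2) - v * (d * t ^ 2)) / (u * t - s * v) := by
    rw [eq_div_iff hD]; linear_combination t * h3 - v * k3
  have e4 : b20 = (u * (d * s ^ 2) - s * (c * u ^ 2)) / (u * t - s * v) := by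
    rw [eq_div_iff hD]; linear_combination u * k1 - s * h1
  have e5 : b11 = (u * (d * (s * t)) - s * (c * (u * v))) / (u * t - s * v) := by
    rw [eq_div_iff hD]; linear_combination u * k2 - s * h2
  have e6 : b02 = (u * (d * t ^ 2) - s * (c * v ^ 2)) / (u * t - s * v) := by
    rw [eq_div_iff hD]; linear_combination u * k3 - s * h3
  rw [e1, e2, e3, e4, e5, e6]
  refine ⟨?_, ?_, ?_⟩ <;> field_simp <;> ring

/-- If a quadratic differential system possesses two couples of distinct parallel
invariant affine lines in two non-proportional directions, then `N = 0` identically. -/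
theorem N_vanishes_of_two_couples_of_parallel_lines
    (a00 a10 a01 a20 a11 a02 b00 b10 b01 b20 b11 b02 : ℝ)
    (hdeg : ¬ (a20 = 0 ∧ a11 = 0 ∧ a02 = 0 ∧ b20 = 0 ∧ b11 = 0 ∧ b02 = 0))
    (u₁ v₁ w₁ w₁' u₂ v₂ w₂ w₂' : ℂ)
    (h₁nz : (u₁, v₁) ≠ (0, 0)) (h₂nz : (u₂, v₂) ≠ (0, 0))
    (hw₁ : w₁ ≠ w₁') (hw₂ : w₂ ≠ w₂')
    (hdir : ¬ ∃ c : ℂ, u₂ = c * u₁ ∧ v₂ = c * v₁)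
    (h₁ : IsInvLine (quadPoly a00 a10 a01 a20 a11 a02)
                    (quadPoly b00 b10 b01 b20 b11 b02) u₁ v₁ w₁)
    (h₁' : IsInvLine (quadPoly a00 a10 a01 a20 a11 a02)
                     (quadPoly b00 b10 b01 b20 b11 b02) u₁ v₁ w₁')
    (h₂ : IsInvLine (quadPoly a00 a10 a01 a20 a11 a02)
                    (quadPoly b00 b10 b01 b20 b11 b02) u₂ v₂ w₂)
    (h₂' : IsInvLine (quadPoly a00 a10 a01 a20 a11 a02)
                     (quadPoly b00 b10 b01 b20 b11 b02) u₂ v₂ w₂') :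
    Npoly a20 a11 a02 b20 b11 b02 = 0 := by
  have E := aux_eval a00 a10 a01 a20 a11 a02 b00 b10 b01 b20 b11 b02
  obtain ⟨c, p1, p2, p3⟩ := aux_sq _ _ _ _ _ _ u₁ v₁ w₁ w₁' h₁nz hw₁ (E _ _ _ h₁) (E _ _ _ h₁')
  obtain ⟨d, r1, r2, r3⟩ := aux_sq _ _ _ _ _ _ u₂ v₂ w₂ w₂' h₂nz hw₂ (E _ _ _ h₂) (E _ _ _ h₂')
  have hD : u₁ * v₂ - u₂ * v₁ ≠ 0 := by
    intro h0
    apply hdir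
    by_cases hu : u₁ = 0
    · have hv : v₁ ≠ 0 := by
        intro hv
        exact h₁nz (by rw [hu, hv])
      have : u₂ = 0 := by simpa [hu, hv] using h0
      exact ⟨v₂ / v₁, by simp [hu, this], by field_simp⟩
    · exact ⟨u₂ / u₁, by field_simp, by field_simp; linear_combination h0⟩
  obtain ⟨n1, n2, n3⟩ := aux_alg _ _ _ _ _ _ _ _ _ _ _ _ hD p1 p2 p3 r1 r2 r3
  norm_cast at n1 n2 n3
  apply MvPolynomial.funext
  intro z
  simp [Npoly, Kpoly, Hpoly, quadForm, pderiv_X]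
  linear_combination 4 * (z 0) ^ 2 * n1 + 8 * (z 0) * (z 1) * n2 + 4 * (z 1) ^ 2 * n3
end
end
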